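/- For matrices X, Y ∈ ℝ^{n₁×n₂} with K = min(n₁, n₂) and 1 ≤ s ≤ K, the nuclear norm satisfies ‖X + Y‖_* ≥ (∑_{i=1}^s σ_i(X) − ∑_{i=s+1}^K σ_i(X)) − (∑_{i=1}^s σ_i(Y) − ∑_{i=s+1}^K σ_i(Y)), where σ_i(·) denotes the singular values in decreasing order. -/

import Mathlib

open scoped BigOperators

/-- `σ` lists the singular values of `M` in nonincreasing order:
`M = U D V` with `U, V` orthogonal and `D` the rectangular diagonal matrix of the `σ i ≥ 0`. -/
def IsSingularValues {n₁ n₂ : ℕ} (M : Matrix (Fin n₁) (Fin n₂) ℝ)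
    (σ : Fin (min n₁ n₂) → ℝ) : Prop :=
  Antitone σ ∧ (∀ i, 0 ≤ σ i) ∧
  ∃ (U : Matrix (Fin n₁) (Fin n₁) ℝ) (V : Matrix (Fin n₂) (Fin n₂) ℝ),
    U * U.transpose = 1 ∧ V * V.transpose = 1 ∧
    M = U * (Matrix.of fun (i : Fin n₁) (j : Fin n₂) =>
        if h : (i : ℕ) = (j : ℕ) ∧ (i : ℕ) < min n₁ n₂ then σ ⟨(i : ℕ), h.2⟩ else 0) * V

open Matrix in
/-- Spectral package for a real symmetric matrix. -/
structure SpecPkg {ι : Type} [Fintype ι] (N : ℕ) (H : Matrix ι ι ℝ) (ev : Fin N → ℝ)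
    (c : (ι → ℝ) →ₗ[ℝ] (Fin N → ℝ)) : Prop where
  anti : Antitone ev
  normsq : ∀ x, x ⬝ᵥ x = ∑ k, c x k ^ 2
  form : ∀ x, x ⬝ᵥ (H *ᵥ x) = ∑ k, ev k * c x k ^ 2
  tr : H.trace = ∑ k, ev k

open Matrix in
theorem exists_specPkg {ι : Type} [Fintype ι] [DecidableEq ι] (N : ℕ) (hN : Fintype.card ι = N)
    (H : Matrix ι ι ℝ) (hH : Hᵀ = H) : ∃ ev c, SpecPkg N H ev c := by
  have hH' : H.IsHermitian := by
    rw [Matrix.IsHermitian, Matrix.conjTranspose_eq_transpose_of_trivial, hH]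
  have hT := Matrix.isSymmetric_toEuclideanLin_iff.mpr hH'
  have hn : Module.finrank ℝ (EuclideanSpace ℝ ι) = N := by rw [finrank_euclideanSpace, hN]
  set b := hT.eigenvectorBasis hn with hb
  have hc : ∀ (x : ι → ℝ) k, b.repr (WithLp.toLp 2 x) k = inner ℝ (b k) (WithLp.toLp 2 x) :=
    fun x k => b.repr_apply_apply _ _
  refine ⟨hT.eigenvalues hn, ((WithLp.linearEquiv 2 ℝ (Fin N → ℝ)).toLinearMap ∘ₗ
    b.repr.toLinearEquiv.toLinearMap ∘ₗ (WithLp.linearEquiv 2 ℝ (ι → ℝ)).symm.toLinearMap),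
    hT.eigenvalues_antitone hn, ?_, ?_, ?_⟩
  · intro x
    have h := b.sum_inner_mul_inner (WithLp.toLp 2 x) (WithLp.toLp 2 x)
    have h2 : x ⬝ᵥ x = inner ℝ (WithLp.toLp 2 x) (WithLp.toLp 2 x) := by
      rw [EuclideanSpace.inner_eq_star_dotProduct]; simp
    rw [h2, ← h]
    refine Finset.sum_congr rfl fun k _ => ?_
    simp [hc, real_inner_comm, sq]
  · intro x
    have h := b.sum_inner_mul_inner (WithLp.toLp 2 x) (H.toEuclideanLin (WithLp.toLp 2 x))
    have h2 : x ⬝ᵥ (H *ᵥ x) = inner ℝ (WithLp.toLp 2 x) (H.toEuclideanLin (WithLp.toLp 2 x)) := by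
      simp [EuclideanSpace.inner_eq_star_dotProduct, dotProduct_comm]
    rw [h2, ← h]
    refine Finset.sum_congr rfl fun k _ => ?_
    rw [← hT, hT.apply_eigenvectorBasis hn k, inner_smul_left]
    simp [hc, real_inner_comm, sq]
    ring
  · have h := hT.trace_eq_sum_eigenvalues hn
    have h' : LinearMap.trace ℝ _ H.toEuclideanLin = H.trace := by
      rw [Matrix.toEuclideanLin_eq_toLin_orthonormal, Matrix.trace_toLin_eq]
    rw [h'] at h
    simpa using h

open Matrix in
theorem inter_ne {ι κ : Type} [Fintype ι] [Fintype κ] (W : Submodule ℝ (ι → ℝ))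
    (L : (ι → ℝ) →ₗ[ℝ] (κ → ℝ)) (h : Fintype.card κ < Module.finrank ℝ W) :
    ∃ x ∈ W, x ≠ 0 ∧ L x = 0 := by
  have := (L ∘ₗ W.subtype).ker_ne_bot_of_finrank_lt (by simpa using h)
  obtain ⟨x, hx, hx0⟩ := Submodule.exists_mem_ne_zero_of_ne_bot this
  exact ⟨x, x.2, by simpa using hx0, by simpa using hx⟩

theorem finrank_ker_ge {ι κ : Type} [Fintype ι] [Fintype κ] (L : (ι → ℝ) →ₗ[ℝ] (κ → ℝ)) :
    Fintype.card ι ≤ Module.finrank ℝ (LinearMap.ker L) + Fintype.card κ := by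
  have h1 := L.finrank_range_add_finrank_ker
  have h2 := (LinearMap.range L).finrank_le
  simp at h1 h2
  omega

open Matrix in
theorem dot_self_pos {ι : Type} [Fintype ι] {x : ι → ℝ} (hx : x ≠ 0) : 0 < x ⬝ᵥ x := by
  have h0 : 0 ≤ x ⬝ᵥ x := Finset.sum_nonneg fun i _ => mul_self_nonneg _
  exact lt_of_le_of_ne h0 fun h => hx (dotProduct_self_eq_zero.mp h.symm)

open Matrix in
theorem SpecPkg.low {ι : Type} [Fintype ι] {N : ℕ} {H : Matrix ι ι ℝ} {ev : Fin N → ℝ}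
    {c : (ι → ℝ) →ₗ[ℝ] (Fin N → ℝ)} (S : SpecPkg N H ev c) (i : Fin N)
    (W : Submodule ℝ (ι → ℝ)) (hW : (i : ℕ) + 1 ≤ Module.finrank ℝ W) (a : ℝ)
    (h : ∀ x ∈ W, a * (x ⬝ᵥ x) ≤ x ⬝ᵥ (H *ᵥ x)) : a ≤ ev i := by
  obtain ⟨x, hx, hx0, hL⟩ := inter_ne W
    ((LinearMap.funLeft ℝ ℝ (fun k : Fin i => (⟨k, k.2.trans i.2⟩ : Fin N))) ∘ₗ c)
    (by simpa using hW)
  have hz : ∀ k : Fin N, k < i → c x k = 0 := fun k hk => by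
    have := congrFun hL ⟨k, hk⟩
    simpa [LinearMap.funLeft_apply] using this
  have h1 : x ⬝ᵥ (H *ᵥ x) ≤ ev i * (x ⬝ᵥ x) := by
    rw [S.form, S.normsq, Finset.mul_sum]
    refine Finset.sum_le_sum fun k _ => ?_
    rcases lt_or_ge k i with hk | hk
    · simp [hz k hk]
    · exact mul_le_mul_of_nonneg_right (S.anti hk) (sq_nonneg _)
  exact le_of_mul_le_mul_right ((h x hx).trans h1) (dot_self_pos hx0)

open Matrix in
theorem SpecPkg.up {ι : Type} [Fintype ι] {N : ℕ} {H : Matrix ι ι ℝ} {ev : Fin N → ℝ}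
    {c : (ι → ℝ) →ₗ[ℝ] (Fin N → ℝ)} (S : SpecPkg N H ev c) (i : Fin N)
    (W : Submodule ℝ (ι → ℝ)) (hW : N ≤ Module.finrank ℝ W + i) (a : ℝ)
    (h : ∀ x ∈ W, x ⬝ᵥ (H *ᵥ x) ≤ a * (x ⬝ᵥ x)) : ev i ≤ a := by
  obtain ⟨x, hx, hx0, hL⟩ := inter_ne W
    ((LinearMap.funLeft ℝ ℝ (fun k : Fin (N - 1 - i) => (⟨i + 1 + k, by omega⟩ : Fin N))) ∘ₗ c)
    (by have := i.2; simp; omega)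
  have hz : ∀ k : Fin N, i < k → c x k = 0 := fun k hk => by
    have hk' : (i : ℕ) < k := hk
    have := congrFun hL ⟨k - i - 1, by omega⟩
    have e : (⟨i + 1 + (k - i - 1), by omega⟩ : Fin N) = k := by ext; simp; omega
    simpa [LinearMap.funLeft_apply, e] using this
  have h1 : ev i * (x ⬝ᵥ x) ≤ x ⬝ᵥ (H *ᵥ x) := by
    rw [S.form, S.normsq, Finset.mul_sum]
    refine Finset.sum_le_sum fun k _ => ?_
    rcases lt_or_ge i k with hk | hk
    · simp [hz k hk]
    · exact mul_le_mul_of_nonneg_right (S.anti hk) (sq_nonneg _)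
  exact le_of_mul_le_mul_right (h1.trans (h x hx)) (dot_self_pos hx0)

open Matrix in
theorem SpecPkg.mono {ι : Type} [Fintype ι] {N : ℕ} (hN : Fintype.card ι = N)
    {H G : Matrix ι ι ℝ} {ev ev' : Fin N → ℝ}
    {c c' : (ι → ℝ) →ₗ[ℝ] (Fin N → ℝ)} (S : SpecPkg N H ev c) (S' : SpecPkg N G ev' c')
    (h : ∀ x, x ⬝ᵥ (H *ᵥ x) ≤ x ⬝ᵥ (G *ᵥ x)) (i : Fin N) : ev i ≤ ev' i := by
  have hr := finrank_ker_ge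
    ((LinearMap.funLeft ℝ ℝ (fun k : Fin (N - 1 - i) => (⟨i + 1 + k, by omega⟩ : Fin N))) ∘ₗ c)
  refine S'.low i (LinearMap.ker
    ((LinearMap.funLeft ℝ ℝ (fun k : Fin (N - 1 - i) => (⟨i + 1 + k, by omega⟩ : Fin N))) ∘ₗ c))
    (by have := i.2; rw [Fintype.card_fin] at hr; omega) _ ?_
  intro x hL
  refine le_trans ?_ (h x)
  have hz : ∀ k : Fin N, i < k → c x k = 0 := fun k hk => by
    have hk' : (i : ℕ) < k := hk
    have := congrFun (LinearMap.mem_ker.mp hL) ⟨k - i - 1, by omega⟩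
    have e : (⟨i + 1 + (k - i - 1), by omega⟩ : Fin N) = k := by ext; simp; omega
    simpa [LinearMap.funLeft_apply, e] using this
  rw [S.form, S.normsq, Finset.mul_sum]
  refine Finset.sum_le_sum fun k _ => ?_
  rcases lt_or_ge i k with hk | hk
  · simp [hz k hk]
  · exact mul_le_mul_of_nonneg_right (S.anti hk) (sq_nonneg _)

open Matrix in
theorem svd_form {n₁ n₂ : ℕ} {M : Matrix (Fin n₁) (Fin n₂) ℝ} {σ : Fin (min n₁ n₂) → ℝ}
    (h : IsSingularValues M σ) :
    ∃ (U : Matrix (Fin n₁) (Fin n₁) ℝ) (V : Matrix (Fin n₂) (Fin n₂) ℝ),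
      U * Uᵀ = 1 ∧ V * Vᵀ = 1 ∧ ∀ x y, x ⬝ᵥ (M *ᵥ y) =
        ∑ k : Fin (min n₁ n₂), σ k * (Uᵀ *ᵥ x) (Fin.castLE (min_le_left _ _) k) *
          (V *ᵥ y) (Fin.castLE (min_le_right _ _) k) := by
  obtain ⟨-, -, U, V, hU, hV, hM⟩ := h
  refine ⟨U, V, hU, hV, fun x y => ?_⟩
  have hD : (Matrix.of fun (i : Fin n₁) (j : Fin n₂) =>
        if h : (i : ℕ) = (j : ℕ) ∧ (i : ℕ) < min n₁ n₂ then σ ⟨(i : ℕ), h.2⟩ else 0) =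
      ∑ k : Fin (min n₁ n₂), σ k • vecMulVec (Pi.single (Fin.castLE (min_le_left _ _) k) (1 : ℝ))
        (Pi.single (Fin.castLE (min_le_right _ _) k) (1 : ℝ)) := by
    ext i j
    rw [Matrix.sum_apply, Matrix.of_apply]
    simp only [Matrix.smul_apply, vecMulVec_apply, Pi.single_apply, smul_eq_mul]
    split_ifs with hij
    · rw [Finset.sum_eq_single (⟨i, hij.2⟩ : Fin (min n₁ n₂))]
      · simp [Fin.ext_iff, hij.1.symm]
      · intro b _ hb
        have : ¬ i = Fin.castLE (min_le_left _ _) b := fun e => hb (by ext; simp [e])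
        simp [this]
      · simp
    · symm
      refine Finset.sum_eq_zero fun k _ => ?_
      by_cases h1 : i = Fin.castLE (min_le_left _ _) k
      · have : ¬ j = Fin.castLE (min_le_right _ _) k := fun e => hij (by
          subst h1; subst e; exact ⟨rfl, k.2⟩)
        simp [this]
      · simp [h1]
  rw [hM, hD, ← Matrix.mulVec_mulVec, ← Matrix.mulVec_mulVec, Matrix.dotProduct_mulVec,
    ← Matrix.mulVec_transpose, Matrix.sum_mulVec, dotProduct_sum]
  refine Finset.sum_congr rfl fun k _ => ?_
  rw [Matrix.smul_mulVec, dotProduct_smul, Matrix.vecMulVec_mulVec]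
  simp
  ring

open Matrix in
theorem orth_normsq {n : ℕ} {U : Matrix (Fin n) (Fin n) ℝ} (h : U * Uᵀ = 1) (x : Fin n → ℝ) :
    ∑ k, (Uᵀ *ᵥ x) k ^ 2 = x ⬝ᵥ x := by
  have : (Uᵀ *ᵥ x) ⬝ᵥ (Uᵀ *ᵥ x) = x ⬝ᵥ x := by
    rw [Matrix.dotProduct_mulVec, ← Matrix.mulVec_transpose, Matrix.transpose_transpose,
      Matrix.mulVec_mulVec, h, Matrix.one_mulVec]
  rw [← this]
  simp [dotProduct, sq]

theorem sum_castLE {K n : ℕ} (h : K ≤ n) (f : Fin n → ℝ) (hf : ∀ a : Fin n, K ≤ a → f a = 0) :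
    ∑ k : Fin K, f (Fin.castLE h k) = ∑ a, f a := by
  refine Fintype.sum_of_injective _ (Fin.castLE_injective h) _ _ ?_ (fun _ => rfl)
  intro a ha
  refine hf a ?_
  by_contra hlt
  exact ha ⟨⟨a, by omega⟩, by ext; rfl⟩

theorem sum_castLE_le {K n : ℕ} (h : K ≤ n) (f : Fin n → ℝ) (hf : ∀ a : Fin n, 0 ≤ f a) :
    ∑ k : Fin K, f (Fin.castLE h k) ≤ ∑ a, f a := by
  have : ∑ k : Fin K, f (Fin.castLE h k)
      = ∑ a ∈ Finset.univ.map ⟨_, Fin.castLE_injective h⟩, f a := by simp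
  rw [this]
  exact Finset.sum_le_sum_of_subset_of_nonneg (Finset.subset_univ _) fun a _ _ => hf a

section kernels
open Matrix

theorem kern_one {n₁ n₂ : ℕ} {σ : Fin (min n₁ n₂) → ℝ} (hσ : Antitone σ)
    (p : (Fin n₁ ⊕ Fin n₂ → ℝ) →ₗ[ℝ] (Fin n₁ → ℝ))
    (q : (Fin n₁ ⊕ Fin n₂ → ℝ) →ₗ[ℝ] (Fin n₂ → ℝ))
    (hpq : ∀ z, z ⬝ᵥ z = ∑ k, p z k ^ 2 + ∑ k, q z k ^ 2) (i : Fin (min n₁ n₂)) :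
    ∃ W : Submodule ℝ (Fin n₁ ⊕ Fin n₂ → ℝ), (i : ℕ) + 1 ≤ Module.finrank ℝ W ∧
      ∀ z ∈ W, σ i * (z ⬝ᵥ z) ≤ 2 * ∑ k : Fin (min n₁ n₂),
        σ k * p z (Fin.castLE (min_le_left _ _) k) * q z (Fin.castLE (min_le_right _ _) k) := by
  have hi := i.2
  let L : (Fin n₁ ⊕ Fin n₂ → ℝ) →ₗ[ℝ] (Fin n₁ ⊕ Fin (n₂ - 1 - i) → ℝ) :=
    { toFun := fun z => Sum.elim
        (fun a => p z a - if h : (a : ℕ) ≤ i then q z ⟨a, by omega⟩ else 0)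
        (fun b => q z ⟨i + 1 + b, by omega⟩)
      map_add' := by
        intro x y
        ext (a | b)
        · by_cases h : (a : ℕ) ≤ i <;> simp [h]
          ring
        · simp
      map_smul' := by
        intro r x
        ext (a | b)
        · by_cases h : (a : ℕ) ≤ i <;> simp [h]
          ring
        · simp }
  refine ⟨LinearMap.ker L, ?_, ?_⟩
  · have := finrank_ker_ge L
    simp only [Fintype.card_sum, Fintype.card_fin] at this
    omega
  · intro z hz
    have hz' : L z = 0 := hz
    have e1 : ∀ a : Fin n₁, p z a - (if h : (a : ℕ) ≤ i then q z ⟨a, by omega⟩ else 0) = 0 :=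
      fun a => congrFun hz' (Sum.inl a)
    have e2 : ∀ b : Fin n₂, (i : ℕ) < b → q z b = 0 := fun b hb => by
      have h : q z ⟨i + 1 + (b - i - 1), by omega⟩ = 0 :=
        congrFun hz' (Sum.inr ⟨b - i - 1, by omega⟩)
      have e : (⟨i + 1 + (b - i - 1), by omega⟩ : Fin n₂) = b := by ext; simp; omega
      rwa [e] at h
    have e3 : ∀ a : Fin n₁, (i : ℕ) < a → p z a = 0 := fun a ha => by
      have := e1 a
      rw [dif_neg (by omega)] at this
      simpa using this
    rw [hpq, ← sum_castLE (min_le_left n₁ n₂) (fun a => p z a ^ 2)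
        (fun a ha => by simp [e3 a (by omega)]),
      ← sum_castLE (min_le_right n₁ n₂) (fun a => q z a ^ 2)
        (fun a ha => by simp [e2 a (by omega)]),
      ← Finset.sum_add_distrib, Finset.mul_sum, Finset.mul_sum]
    refine Finset.sum_le_sum fun k _ => ?_
    rcases lt_or_ge i k with hk | hk
    · have hk' : (i : ℕ) < k := hk
      simp [e2 (Fin.castLE (min_le_right _ _) k) hk', e3 (Fin.castLE (min_le_left _ _) k) hk']
    · have hk' : (k : ℕ) ≤ i := hk
      have h1 := e1 (Fin.castLE (min_le_left _ _) k)
      rw [dif_pos (by simpa using hk')] at h1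
      have h2 : p z (Fin.castLE (min_le_left _ _) k) = q z (Fin.castLE (min_le_right _ _) k) := by
        exact sub_eq_zero.mp h1
      rw [h2]
      nlinarith [hσ hk, sq_nonneg (q z (Fin.castLE (min_le_right n₁ n₂) k))]

theorem kern_two {n₁ n₂ : ℕ} {σ : Fin (min n₁ n₂) → ℝ} (hσ : Antitone σ) (h0 : ∀ i, 0 ≤ σ i)
    (p : (Fin n₁ ⊕ Fin n₂ → ℝ) →ₗ[ℝ] (Fin n₁ → ℝ))
    (q : (Fin n₁ ⊕ Fin n₂ → ℝ) →ₗ[ℝ] (Fin n₂ → ℝ))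
    (hpq : ∀ z, z ⬝ᵥ z = ∑ k, p z k ^ 2 + ∑ k, q z k ^ 2) (i : Fin (min n₁ n₂)) :
    ∃ W : Submodule ℝ (Fin n₁ ⊕ Fin n₂ → ℝ), n₁ + n₂ ≤ Module.finrank ℝ W + i ∧
      ∀ z ∈ W, - σ i * (z ⬝ᵥ z) ≤ 2 * ∑ k : Fin (min n₁ n₂),
        σ k * p z (Fin.castLE (min_le_left _ _) k) * q z (Fin.castLE (min_le_right _ _) k) := by
  have hi := i.2
  let L : (Fin n₁ ⊕ Fin n₂ → ℝ) →ₗ[ℝ] (Fin i → ℝ) :=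
    LinearMap.funLeft ℝ ℝ (fun k : Fin i => (⟨k, by omega⟩ : Fin n₁)) ∘ₗ p -
    LinearMap.funLeft ℝ ℝ (fun k : Fin i => (⟨k, by omega⟩ : Fin n₂)) ∘ₗ q
  refine ⟨LinearMap.ker L, ?_, ?_⟩
  · have := finrank_ker_ge L
    simpa using this
  · intro z hz
    have hz' : L z = 0 := hz
    have e1 : ∀ k : Fin (min n₁ n₂), k < i → p z (Fin.castLE (min_le_left _ _) k) =
        q z (Fin.castLE (min_le_right _ _) k) := fun k hk => by
      have h := congrFun hz' ⟨k, hk⟩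
      exact sub_eq_zero.mp h
    have l1 := sum_castLE_le (min_le_left n₁ n₂) (fun a => p z a ^ 2) (fun a => sq_nonneg _)
    have l2 := sum_castLE_le (min_le_right n₁ n₂) (fun a => q z a ^ 2) (fun a => sq_nonneg _)
    have l3 : -σ i * (z ⬝ᵥ z) ≤ -σ i * (∑ k : Fin (min n₁ n₂),
        (p z (Fin.castLE (min_le_left _ _) k) ^ 2 + q z (Fin.castLE (min_le_right _ _) k) ^ 2)) := by
      rw [hpq, Finset.sum_add_distrib]
      have := mul_le_mul_of_nonneg_left (add_le_add l1 l2) (h0 i)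
      linarith
    refine l3.trans ?_
    rw [Finset.mul_sum, Finset.mul_sum]
    refine Finset.sum_le_sum fun k _ => ?_
    rcases lt_or_ge k i with hk | hk
    · rw [e1 k hk]
      have := mul_nonneg (h0 i) (sq_nonneg (q z (Fin.castLE (min_le_right n₁ n₂) k)))
      have := mul_nonneg (h0 k) (sq_nonneg (q z (Fin.castLE (min_le_right n₁ n₂) k)))
      nlinarith
    · generalize p z (Fin.castLE (min_le_left n₁ n₂) k) = a
      generalize q z (Fin.castLE (min_le_right n₁ n₂) k) = b
      have h1 := hσ hk
      have h2 := mul_nonneg (h0 k) (sq_nonneg (a + b))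
      have h3 := mul_nonneg (sub_nonneg.mpr h1) (add_nonneg (sq_nonneg a) (sq_nonneg b))
      nlinarith

end kernels

section final
open Matrix

/-- left singular coordinates -/
def pMap {n₁ n₂ : ℕ} (U : Matrix (Fin n₁) (Fin n₁) ℝ) :
    (Fin n₁ ⊕ Fin n₂ → ℝ) →ₗ[ℝ] (Fin n₁ → ℝ) :=
  Uᵀ.mulVecLin ∘ₗ LinearMap.funLeft ℝ ℝ Sum.inl

/-- right singular coordinates -/
def qMap {n₁ n₂ : ℕ} (V : Matrix (Fin n₂) (Fin n₂) ℝ) :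
    (Fin n₁ ⊕ Fin n₂ → ℝ) →ₗ[ℝ] (Fin n₂ → ℝ) :=
  V.mulVecLin ∘ₗ LinearMap.funLeft ℝ ℝ Sum.inr

theorem pq_normsq {n₁ n₂ : ℕ} {U : Matrix (Fin n₁) (Fin n₁) ℝ} {V : Matrix (Fin n₂) (Fin n₂) ℝ}
    (hU : U * Uᵀ = 1) (hV : V * Vᵀ = 1) (z : Fin n₁ ⊕ Fin n₂ → ℝ) :
    z ⬝ᵥ z = ∑ k, pMap U z k ^ 2 + ∑ k, qMap V z k ^ 2 := by
  have h1 := orth_normsq hU (z ∘ Sum.inl)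
  have h2 := orth_normsq (U := Vᵀ) (by rw [transpose_transpose]; exact mul_eq_one_comm.mp hV)
    (z ∘ Sum.inr)
  rw [transpose_transpose] at h2
  have e1 : ∀ k, pMap U z k = (Uᵀ *ᵥ (z ∘ Sum.inl)) k := fun k => rfl
  have e2 : ∀ k, qMap V z k = (V *ᵥ (z ∘ Sum.inr)) k := fun k => rfl
  simp only [e1, e2]
  rw [h1, h2]
  simp [dotProduct]

theorem sv_pkg {n₁ n₂ : ℕ} {M : Matrix (Fin n₁) (Fin n₂) ℝ} {σ : Fin (min n₁ n₂) → ℝ}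
    (h : IsSingularValues M σ) (i : Fin (min n₁ n₂)) :
    (∃ W : Submodule ℝ (Fin n₁ ⊕ Fin n₂ → ℝ), (i : ℕ) + 1 ≤ Module.finrank ℝ W ∧
      ∀ z ∈ W, σ i * (z ⬝ᵥ z) ≤ 2 * ((z ∘ Sum.inl) ⬝ᵥ (M *ᵥ (z ∘ Sum.inr)))) ∧
    (∃ W : Submodule ℝ (Fin n₁ ⊕ Fin n₂ → ℝ), n₁ + n₂ ≤ Module.finrank ℝ W + i ∧
      ∀ z ∈ W, - σ i * (z ⬝ᵥ z) ≤ 2 * ((z ∘ Sum.inl) ⬝ᵥ (M *ᵥ (z ∘ Sum.inr)))) := by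
  obtain ⟨U, V, hU, hV, hF⟩ := svd_form h
  simp only [hF]
  exact ⟨kern_one h.1 (pMap U) (qMap V) (pq_normsq hU hV) i,
    kern_two h.1 h.2.1 (pMap U) (qMap V) (pq_normsq hU hV) i⟩

theorem pos_part {n₁ n₂ : ℕ} {M : Matrix (Fin n₁) (Fin n₂) ℝ} {σ : Fin (min n₁ n₂) → ℝ}
    (h : IsSingularValues M σ) :
    ∃ P : Matrix (Fin n₁ ⊕ Fin n₂) (Fin n₁ ⊕ Fin n₂) ℝ, Pᵀ = P ∧ P.trace = ∑ k, σ k ∧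
      (∀ z, 0 ≤ z ⬝ᵥ (P *ᵥ z)) ∧
      (∀ z, 2 * ((z ∘ Sum.inl) ⬝ᵥ (M *ᵥ (z ∘ Sum.inr))) ≤ z ⬝ᵥ (P *ᵥ z)) := by
  obtain ⟨U, V, hU, hV, hF⟩ := svd_form h
  have h0 := h.2.1
  let w : Fin (min n₁ n₂) → Fin n₁ ⊕ Fin n₂ → ℝ := fun k =>
    Sum.elim (fun a => U a (Fin.castLE (min_le_left _ _) k))
      (fun b => V (Fin.castLE (min_le_right _ _) k) b)
  have hw : ∀ k z, w k ⬝ᵥ z = (Uᵀ *ᵥ (z ∘ Sum.inl)) (Fin.castLE (min_le_left _ _) k) +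
      (V *ᵥ (z ∘ Sum.inr)) (Fin.castLE (min_le_right _ _) k) := fun k z => by
    simp [w, dotProduct, mulVec]
  have hww : ∀ k, w k ⬝ᵥ w k = 2 := fun k => by
    have hU' : Uᵀ * U = 1 := mul_eq_one_comm.mp hU
    have h1 := congrFun (congrFun hU' (Fin.castLE (min_le_left _ _) k))
      (Fin.castLE (min_le_left _ _) k)
    have h2 := congrFun (congrFun hV (Fin.castLE (min_le_right _ _) k))
      (Fin.castLE (min_le_right _ _) k)
    simp only [mul_apply, transpose_apply, one_apply_eq] at h1 h2
    simp only [w, dotProduct, Fintype.sum_sum_type, Sum.elim_inl, Sum.elim_inr]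
    rw [h1, h2]; norm_num
  have hP : ∀ z, z ⬝ᵥ ((∑ k, (σ k / 2) • vecMulVec (w k) (w k)) *ᵥ z) =
      ∑ k, σ k / 2 * (w k ⬝ᵥ z) ^ 2 := fun z => by
    rw [Matrix.sum_mulVec, dotProduct_sum]
    refine Finset.sum_congr rfl fun k _ => ?_
    rw [Matrix.smul_mulVec, dotProduct_smul, Matrix.vecMulVec_mulVec]
    simp [dotProduct_comm z (w k), sq]
  refine ⟨∑ k, (σ k / 2) • vecMulVec (w k) (w k), ?_, ?_, ?_, ?_⟩
  · simp [transpose_sum, transpose_smul, transpose_vecMulVec]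
  · rw [trace_sum]
    refine Finset.sum_congr rfl fun k _ => ?_
    rw [trace_smul, trace_vecMulVec, hww]
    simp
  · intro z
    rw [hP]
    exact Finset.sum_nonneg fun k _ => mul_nonneg (by linarith [h0 k]) (sq_nonneg _)
  · intro z
    rw [hP, hF, Finset.mul_sum]
    refine Finset.sum_le_sum fun k _ => ?_
    rw [hw]
    generalize (Uᵀ *ᵥ (z ∘ Sum.inl)) (Fin.castLE (min_le_left _ _) k) = a
    generalize (V *ᵥ (z ∘ Sum.inr)) (Fin.castLE (min_le_right _ _) k) = b
    nlinarith [mul_nonneg (h0 k) (sq_nonneg (a - b))]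

theorem dil_form {n₁ n₂ : ℕ} (M : Matrix (Fin n₁) (Fin n₂) ℝ) (z : Fin n₁ ⊕ Fin n₂ → ℝ) :
    z ⬝ᵥ ((fromBlocks 0 (-M) (-Mᵀ) 0) *ᵥ z) =
      - (2 * ((z ∘ Sum.inl) ⬝ᵥ (M *ᵥ (z ∘ Sum.inr)))) := by
  have e : z = Sum.elim (z ∘ Sum.inl) (z ∘ Sum.inr) := by ext (a | b) <;> rfl
  have h : (z ∘ Sum.inr) ⬝ᵥ (Mᵀ *ᵥ (z ∘ Sum.inl)) = (z ∘ Sum.inl) ⬝ᵥ (M *ᵥ (z ∘ Sum.inr)) := by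
    rw [mulVec_transpose, dotProduct_comm, dotProduct_mulVec]
  rw [fromBlocks_mulVec]
  conv_lhs => rw [e]
  rw [sumElim_dotProduct_sumElim]
  simp only [Sum.elim_comp_inl, Sum.elim_comp_inr, zero_mulVec, neg_mulVec, zero_add, add_zero,
    dotProduct_neg, h]
  ring

end final

open Matrix in
theorem stmt2 {n₁ n₂ : ℕ} (s : ℕ) (hs : 1 ≤ s) (hsK : s ≤ min n₁ n₂)
    (X Y : Matrix (Fin n₁) (Fin n₂) ℝ) (σX σY σS : Fin (min n₁ n₂) → ℝ)
    (hX : IsSingularValues X σX) (hY : IsSingularValues Y σY)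
    (hS : IsSingularValues (X + Y) σS) :
    ∑ i, σS i ≥
      ((∑ i ∈ Finset.univ.filter (fun i : Fin (min n₁ n₂) => (i : ℕ) < s), σX i)
        - ∑ i ∈ Finset.univ.filter (fun i : Fin (min n₁ n₂) => s ≤ (i : ℕ)), σX i)
      - ((∑ i ∈ Finset.univ.filter (fun i : Fin (min n₁ n₂) => (i : ℕ) < s), σY i)
        - ∑ i ∈ Finset.univ.filter (fun i : Fin (min n₁ n₂) => s ≤ (i : ℕ)), σY i) := by
  obtain ⟨P, hPt, hPtr, hP0, hPS⟩ := pos_part hS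
  have hN : Fintype.card (Fin n₁ ⊕ Fin n₂) = n₁ + n₂ := by simp
  let B : Matrix (Fin n₁ ⊕ Fin n₂) (Fin n₁ ⊕ Fin n₂) ℝ := fromBlocks 0 (-Y) (-Yᵀ) 0
  have hB : Bᵀ = B := by simp [B, fromBlocks_transpose]
  have hBf : ∀ z, z ⬝ᵥ (B *ᵥ z) = - (2 * ((z ∘ Sum.inl) ⬝ᵥ (Y *ᵥ (z ∘ Sum.inr)))) := dil_form Y
  obtain ⟨lam, c, SB⟩ := exists_specPkg _ hN B hB
  obtain ⟨mu, c', SM⟩ := exists_specPkg _ hN (B + P) (by rw [transpose_add, hB, hPt])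
  have hMf : ∀ z, z ⬝ᵥ ((B + P) *ᵥ z) = z ⬝ᵥ (B *ᵥ z) + z ⬝ᵥ (P *ᵥ z) := fun z => by
    rw [add_mulVec, dotProduct_add]
  have hMX : ∀ z, 2 * ((z ∘ Sum.inl) ⬝ᵥ (X *ᵥ (z ∘ Sum.inr))) ≤ z ⬝ᵥ ((B + P) *ᵥ z) := fun z => by
    have := hPS z
    rw [add_mulVec, dotProduct_add] at this
    rw [hMf, hBf]
    linarith
  have hmono : ∀ j, lam j ≤ mu j :=
    SB.mono hN SM fun z => by rw [hMf]; linarith [hP0 z]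
  have htr : ∑ j, (mu j - lam j) = ∑ i, σS i := by
    rw [Finset.sum_sub_distrib, ← SM.tr, ← SB.tr, trace_add, hPtr]; ring
  -- the index map
  let g : Fin (min n₁ n₂) → Fin (n₁ + n₂) := fun i =>
    if (i : ℕ) < s then ⟨i, by omega⟩ else ⟨n₁ + n₂ - 1 - i, by omega⟩
  have hg : Function.Injective g := by
    intro a b hab
    have ha := a.2
    have hb := b.2
    simp only [g] at hab
    split_ifs at hab <;> simp only [Fin.mk.injEq] at hab <;> ext <;> omega
  have key : ∀ i : Fin (min n₁ n₂), (if (i : ℕ) < s then σX i - σY i else σY i - σX i) ≤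
      mu (g i) - lam (g i) := by
    intro i
    have hi := i.2
    obtain ⟨⟨W1, hW1, hF1⟩, ⟨W2, hW2, hF2⟩⟩ := sv_pkg hX i
    obtain ⟨⟨W3, hW3, hF3⟩, ⟨W4, hW4, hF4⟩⟩ := sv_pkg hY i
    by_cases h : (i : ℕ) < s
    · simp only [g, h, if_true]
      have a1 := SM.low ⟨i, by omega⟩ W1 hW1 (σX i) fun z hz => (hF1 z hz).trans (hMX z)
      have a2 := SB.up ⟨i, by omega⟩ W4 hW4 (σY i) fun z hz => by
        rw [hBf]; linarith [hF4 z hz]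
      linarith
    · simp only [g, h, if_false]
      have a1 := SM.low ⟨n₁ + n₂ - 1 - i, by omega⟩ W2 (by simp only; omega) (-σX i)
        fun z hz => (hF2 z hz).trans (hMX z)
      have a2 := SB.up ⟨n₁ + n₂ - 1 - i, by omega⟩ W3 (by simp only; omega) (-σY i) fun z hz => by
        rw [hBf]; linarith [hF3 z hz]
      linarith
  have h1 : ∑ i, (mu (g i) - lam (g i)) ≤ ∑ j, (mu j - lam j) := by
    have : ∑ i, (mu (g i) - lam (g i)) = ∑ j ∈ Finset.univ.map ⟨g, hg⟩, (mu j - lam j) := by simp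
    rw [this]
    exact Finset.sum_le_sum_of_subset_of_nonneg (Finset.subset_univ _)
      fun j _ _ => sub_nonneg.mpr (hmono j)
  have h2 := (Finset.sum_le_sum fun i (_ : i ∈ Finset.univ) => key i).trans h1
  rw [htr, Finset.sum_ite, Finset.sum_sub_distrib, Finset.sum_sub_distrib] at h2
  simp only [not_lt] at h2
  linarith
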